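/- Let k ≥ 1 and ε ∈ (0, 1] with ε(k + 1) > 1 and ε(k + 1) not an integer. Let Z be the example space, let z_1, …, z_k ∈ Z be calibration examples, and let A* : Z → ℝ be an adjusted conformity measure. Define t as the minimum of A*(z_i) over all indices i ∈ {1, …, k} satisfying #{ j ∈ {1, …, k} : A*(z_i) ≥ A*(z_j) } + 1 ≥ ε(k + 1). For an object x, define the inductive conformal prediction set (with the training set reused as calibration set, l = 2k) by Γ^ε(x) = { y : #{ j ∈ {1, …, k} : A*(x, y) ≥ A*(z_j) } + 1 > ε(k + 1) }. Then Γ^ε(x) = { y : A*(x, y) ≥ t }. -/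

import Mathlib

/-- The empirical `ε`-quantile threshold: the minimum of `B i` over indices `i` whose
score rank satisfies `#{j : B j ≤ B i} + 1 ≥ ε (k + 1)`.  Since the set of such scores is
finite and (for `ε ≤ 1`) nonempty, its infimum is its minimum. -/
noncomputable def threshold {k : ℕ} (ε : ℝ) (B : Fin k → ℝ) : ℝ :=
  sInf {t : ℝ | ∃ i : Fin k,
    (((Finset.univ.filter (fun j : Fin k => B j ≤ B i)).card : ℝ) + 1 ≥ ε * (k + 1)) ∧
    B i = t}

/-- If some score is at most `a`, the largest such score has at least as many scores below it
as `a` does. -/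
theorem exists_le_card_filter_le {k : ℕ} (B : Fin k → ℝ) (a : ℝ)
    (h : (Finset.univ.filter (fun j : Fin k => B j ≤ a)).Nonempty) :
    ∃ i, B i ≤ a ∧ (Finset.univ.filter (fun j : Fin k => B j ≤ a)).card ≤
      (Finset.univ.filter (fun j : Fin k => B j ≤ B i)).card := by
  obtain ⟨i, hi, hmax⟩ := Finset.exists_max_image _ B h
  refine ⟨i, (Finset.mem_filter.1 hi).2, Finset.card_le_card fun j hj => ?_⟩
  exact Finset.mem_filter.2 ⟨Finset.mem_univ j, hmax j hj⟩

/-- For `ε ≤ 1` the threshold is attained, as the least score of sufficient rank. -/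
theorem isLeast_threshold {k : ℕ} (hk : 1 ≤ k) {ε : ℝ} (hε1 : ε ≤ 1) (B : Fin k → ℝ) :
    IsLeast {t : ℝ | ∃ i : Fin k,
      (((Finset.univ.filter (fun j : Fin k => B j ≤ B i)).card : ℝ) + 1 ≥ ε * (k + 1)) ∧
      B i = t} (threshold ε B) := by
  set S := {t : ℝ | ∃ i : Fin k,
      (((Finset.univ.filter (fun j : Fin k => B j ≤ B i)).card : ℝ) + 1 ≥ ε * (k + 1)) ∧
      B i = t}
  have hfin : S.Finite :=
    (Set.finite_range B).subset fun t ⟨i, _, hi⟩ => ⟨i, hi⟩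
  have hne : S.Nonempty := by
    have : Nonempty (Fin k) := ⟨⟨0, hk⟩⟩
    obtain ⟨i, hi⟩ := Finite.exists_max B
    refine ⟨B i, i, ?_, rfl⟩
    rw [Finset.filter_true_of_mem fun j _ => hi j, Finset.card_univ, Fintype.card_fin]
    exact mul_le_of_le_one_left (by positivity) hε1
  exact ⟨hne.csInf_mem hfin, fun t ht => csInf_le hfin.bddBelow ht⟩

/-- Proposition 4: with the training set reused as calibration set, the ICP prediction set
`Γ^ε(x) = {y : #{j : A*(x,y) ≥ A*(z j)} + 1 > ε (k+1)}` equals `{y : A*(x,y) ≥ t}` where `t`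
is the empirical `ε`-quantile threshold of the scores `A*(z i)`, provided `ε (k+1) > 1` and
`ε (k+1)` is not an integer. -/
theorem stmt_3 {X Y : Type*} (k : ℕ) (hk : 1 ≤ k)
    (ε : ℝ) (hε : 0 < ε) (hε1 : ε ≤ 1)
    (hgt : 1 < ε * (k + 1)) (hnotint : ¬ ∃ m : ℤ, (m : ℝ) = ε * (k + 1))
    (Astar : X × Y → ℝ) (z : Fin k → X × Y) (x : X) :
    {y : Y |
      (((Finset.univ.filter (fun j : Fin k => Astar (z j) ≤ Astar (x, y))).card : ℝ) + 1
        > ε * (k + 1))}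
    = {y : Y | Astar (x, y) ≥ threshold ε (fun i => Astar (z i))} := by
  have hleast := isLeast_threshold hk hε1 (fun i => Astar (z i))
  ext y
  simp only [Set.mem_ofPred_eq]
  constructor
  · intro hy
    have hpos : 0 < (Finset.univ.filter
        (fun j : Fin k => Astar (z j) ≤ Astar (x, y))).card := by
      have := hgt.trans hy
      exact_mod_cast (lt_add_iff_pos_left (1 : ℝ)).1 this
    obtain ⟨i, hi, hcard⟩ :=
      exists_le_card_filter_le (fun i => Astar (z i)) _ (Finset.card_pos.1 hpos)
    refine (hleast.2 ⟨i, ?_, rfl⟩).trans hi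
    exact hy.le.trans (by gcongr)
  · intro hy
    obtain ⟨i, hi, hit⟩ := hleast.1
    have hcard : (Finset.univ.filter (fun j : Fin k => Astar (z j) ≤ Astar (z i))).card ≤
        (Finset.univ.filter (fun j : Fin k => Astar (z j) ≤ Astar (x, y))).card :=
      Finset.card_le_card <| Finset.monotone_filter_right _ fun j _ hj =>
        hj.trans (hit.le.trans hy)
    refine lt_of_le_of_ne (hi.le.trans (by gcongr)) fun heq => hnotint ?_
    exact ⟨_ + 1, by rw [heq]; push_cast; rfl⟩
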